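/- Let L ≥ 1, let a₁, …, a_L ≥ 0 and p₁, …, p_L > 0 with Σ_ℓ p_ℓ = 1, and let τ⁰ ≥ 0 and θ⁰ > 0 be 'true' parameters. Define on the domain {(τ, θ) : τ ≥ 0, θ > 0} the function J̄(τ, θ) = Σ_{ℓ=1}^L p_ℓ [(a_ℓ τ⁰ + (θ⁰)⁻¹)/(a_ℓ τ + θ⁻¹) + ln(a_ℓ τ + θ⁻¹)]. Then (τ⁰, θ⁰) is a global minimizer of J̄; moreover, if there exist indices ℓ ≠ m with a_ℓ ≠ a_m (so the squared singular value distribution is non-constant), then (τ⁰, θ⁰) is the unique global minimizer. -/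

import Mathlib

open scoped BigOperators

noncomputable section

theorem div_self_add_log_le_div_add_log {c x : ℝ} (hc : 0 < c) (hx : 0 < x) :
    c / c + Real.log c ≤ c / x + Real.log x := by
  have h := Real.log_le_sub_one_of_pos (div_pos hc hx)
  rw [Real.log_div hc.ne' hx.ne'] at h
  rw [div_self hc.ne']
  linarith

theorem eq_of_div_add_log_eq {c x : ℝ} (hc : 0 < c) (hx : 0 < x)
    (heq : c / c + Real.log c = c / x + Real.log x) : x = c := by
  by_contra hne
  have h := Real.log_lt_sub_one_of_pos (div_pos hc hx)
    (fun h1 => hne ((div_eq_one_iff_eq hx.ne').mp h1).symm)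
  rw [Real.log_div hc.ne' hx.ne'] at h
  rw [div_self hc.ne'] at heq
  linarith

/-- The limiting ML objective `J̄(τ, θ) = Σ_ℓ p_ℓ [(a_ℓ τ⁰ + (θ⁰)⁻¹)/(a_ℓ τ + θ⁻¹)
+ ln(a_ℓ τ + θ⁻¹)]` is globally minimized at the true parameters `(τ⁰, θ⁰)`, and the
minimizer is unique whenever the squared singular-value distribution is non-constant. -/
theorem stmt15 (L : ℕ) (hL : 1 ≤ L) (a p : Fin L → ℝ)
    (ha : ∀ ℓ, 0 ≤ a ℓ) (hp : ∀ ℓ, 0 < p ℓ) (hsum : ∑ ℓ, p ℓ = 1)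
    (τ0 θ0 : ℝ) (hτ0 : 0 ≤ τ0) (hθ0 : 0 < θ0)
    (J : ℝ → ℝ → ℝ)
    (hJ : ∀ τ θ, J τ θ =
      ∑ ℓ, p ℓ * ((a ℓ * τ0 + θ0⁻¹) / (a ℓ * τ + θ⁻¹) + Real.log (a ℓ * τ + θ⁻¹))) :
    (∀ τ θ : ℝ, 0 ≤ τ → 0 < θ → J τ0 θ0 ≤ J τ θ) ∧
    ((∃ ℓ m, a ℓ ≠ a m) →
      ∀ τ θ : ℝ, 0 ≤ τ → 0 < θ → J τ θ = J τ0 θ0 → τ = τ0 ∧ θ = θ0) := by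
  have hpos : ∀ τ θ : ℝ, 0 ≤ τ → 0 < θ → ∀ ℓ, 0 < a ℓ * τ + θ⁻¹ := fun τ θ hτ hθ ℓ =>
    add_pos_of_nonneg_of_pos (mul_nonneg (ha ℓ) hτ) (inv_pos.mpr hθ)
  have hle : ∀ τ θ : ℝ, 0 ≤ τ → 0 < θ → ∀ ℓ ∈ Finset.univ,
      p ℓ * ((a ℓ * τ0 + θ0⁻¹) / (a ℓ * τ0 + θ0⁻¹) + Real.log (a ℓ * τ0 + θ0⁻¹)) ≤
      p ℓ * ((a ℓ * τ0 + θ0⁻¹) / (a ℓ * τ + θ⁻¹) + Real.log (a ℓ * τ + θ⁻¹)) :=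
    fun τ θ hτ hθ ℓ _ => mul_le_mul_of_nonneg_left
      (div_self_add_log_le_div_add_log (hpos τ0 θ0 hτ0 hθ0 ℓ) (hpos τ θ hτ hθ ℓ)) (hp ℓ).le
  refine ⟨fun τ θ hτ hθ => ?_, ?_⟩
  · rw [hJ, hJ]
    exact Finset.sum_le_sum (hle τ θ hτ hθ)
  · rintro ⟨ℓ, m, hne⟩ τ θ hτ hθ heq
    rw [hJ, hJ] at heq
    have hterm := (Finset.sum_eq_sum_iff_of_le (hle τ θ hτ hθ)).mp heq.symm
    have hvar : ∀ k, a k * τ + θ⁻¹ = a k * τ0 + θ0⁻¹ := fun k =>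
      eq_of_div_add_log_eq (hpos τ0 θ0 hτ0 hθ0 k) (hpos τ θ hτ hθ k)
        (mul_left_cancel₀ (hp k).ne' (hterm k (Finset.mem_univ k)))
    have hτeq : τ = τ0 := mul_left_cancel₀ (sub_ne_zero.mpr hne) (by
      linear_combination hvar ℓ - hvar m)
    subst hτeq
    exact ⟨rfl, inv_injective (add_left_cancel (hvar ℓ))⟩
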